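/- Let {v_t} satisfy v_t = β₂v_{t-1} + (1-β₂)g_t² with v₀ ≥ 0, 0 < β₂ < 1. Then the Cauchy–Schwarz bound on displacement holds for Adam-like updates: if x_t = x_{t-1} − η·g_t/√(v_t + ε) componentwise with ε > 0, then (x_T − x₀)² ≤ η²T·∑_{t=1}^T g_t²/(v_t + ε) ≤ η²T·(T + (β₂/(1-β₂))·ln((v_T+ε)/(v₀+ε))). -/

import Mathlib

/-- The terms `f 1, …, f n` are the shifts of `f` over `Finset.range n`. -/
theorem sum_Icc_one_eq_sum_range_succ {M : Type*} [AddCommMonoid M] (f : ℕ → M) (n : ℕ) :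
    ∑ t ∈ Finset.Icc 1 n, f t = ∑ t ∈ Finset.range n, f (t + 1) := by
  induction n with
  | zero => simp
  | succ n ih => rw [Finset.sum_Icc_succ_top (by omega), ih, Finset.sum_range_succ]

/-- One step of the logarithmic bound: if `b ≥ β a + (1 - β) c` with `a, b > 0`, then
`c / b` is controlled by the increment of the logarithm. -/
theorem div_le_one_add_mul_log_sub {β a b c : ℝ} (hβ₀ : 0 ≤ β) (hβ₁ : β < 1) (ha : 0 < a)
    (hb : 0 < b) (h : β * a + (1 - β) * c ≤ b) :
    c / b ≤ 1 + β / (1 - β) * (Real.log b - Real.log a) := by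
  have hβ : 0 < 1 - β := sub_pos.2 hβ₁
  have hlog : Real.log a - Real.log b ≤ a / b - 1 := by
    rw [← Real.log_div ha.ne' hb.ne']
    exact Real.log_le_sub_one_of_pos (div_pos ha hb)
  have hdiv : β * (a / b) + (1 - β) * (c / b) ≤ 1 := by
    rw [← mul_div_assoc, ← mul_div_assoc, ← add_div]
    exact (div_le_one hb).2 h
  have hmul := mul_le_mul_of_nonneg_left hlog hβ₀
  have key : (1 - β) * (c / b) ≤ (1 - β) + β * (Real.log b - Real.log a) := by linarith
  calc c / b = (1 - β) * (c / b) / (1 - β) := by field_simp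
    _ ≤ ((1 - β) + β * (Real.log b - Real.log a)) / (1 - β) := by gcongr
    _ = 1 + β / (1 - β) * (Real.log b - Real.log a) := by field_simp

/-- Cauchy–Schwarz displacement bound for Adam-like updates (1-D case). -/
theorem stmt_17 (T : ℕ) (β₂ η ε : ℝ) (hβ₂ : 0 < β₂ ∧ β₂ < 1) (hε : 0 < ε)
    (v g x : ℕ → ℝ) (hv0 : 0 ≤ v 0)
    (hv : ∀ t, v (t + 1) = β₂ * v t + (1 - β₂) * (g (t + 1)) ^ 2)
    (hx : ∀ t, x (t + 1) = x t - η * g (t + 1) / Real.sqrt (v (t + 1) + ε)) :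
    (x T - x 0) ^ 2 ≤ η ^ 2 * T * ∑ t ∈ Finset.Icc 1 T, (g t) ^ 2 / (v t + ε) ∧
      η ^ 2 * T * ∑ t ∈ Finset.Icc 1 T, (g t) ^ 2 / (v t + ε) ≤
        η ^ 2 * T * ((T : ℝ) + β₂ / (1 - β₂) * Real.log ((v T + ε) / (v 0 + ε))) := by
  obtain ⟨hβ₀, hβ₁⟩ := hβ₂
  have hβ : 0 < 1 - β₂ := sub_pos.2 hβ₁
  have hv_nonneg : ∀ t, 0 ≤ v t := by
    intro t
    induction t with
    | zero => exact hv0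
    | succ t ih => rw [hv]; positivity
  have hpos : ∀ t, 0 < v t + ε := fun t => add_pos_of_nonneg_of_pos (hv_nonneg t) hε
  rw [sum_Icc_one_eq_sum_range_succ]
  constructor
  · calc (x T - x 0) ^ 2 = (∑ t ∈ Finset.range T, (x (t + 1) - x t)) ^ 2 := by
          rw [Finset.sum_range_sub]
      _ ≤ T * ∑ t ∈ Finset.range T, (x (t + 1) - x t) ^ 2 := by
          simpa using sq_sum_le_card_mul_sum_sq (s := Finset.range T)
            (f := fun t => x (t + 1) - x t)
      _ = T * ∑ t ∈ Finset.range T, η ^ 2 * (g (t + 1) ^ 2 / (v (t + 1) + ε)) := by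
          congr 1
          refine Finset.sum_congr rfl fun t _ => ?_
          rw [hx, sub_sub_cancel_left, neg_sq, div_pow, Real.sq_sqrt (hpos _).le, mul_pow,
            mul_div_assoc]
      _ = η ^ 2 * T * ∑ t ∈ Finset.range T, g (t + 1) ^ 2 / (v (t + 1) + ε) := by
          rw [← Finset.mul_sum]
          ring
  · refine mul_le_mul_of_nonneg_left ?_ (by positivity)
    calc ∑ t ∈ Finset.range T, g (t + 1) ^ 2 / (v (t + 1) + ε)
        ≤ ∑ t ∈ Finset.range T,
            (1 + β₂ / (1 - β₂) * (Real.log (v (t + 1) + ε) - Real.log (v t + ε))) := by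
          refine Finset.sum_le_sum fun t _ =>
            div_le_one_add_mul_log_sub hβ₀.le hβ₁ (hpos t) (hpos (t + 1)) ?_
          have := mul_pos hβ hε
          linarith [hv t]
      _ = T + β₂ / (1 - β₂) * Real.log ((v T + ε) / (v 0 + ε)) := by
          rw [Finset.sum_add_distrib, ← Finset.mul_sum,
            Finset.sum_range_sub (fun t => Real.log (v t + ε)),
            Real.log_div (hpos T).ne' (hpos 0).ne']
          simp
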